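/- arXiv:1312.7695 — 4 statements merged into one kernel-verified Lean document; each statement's English description precedes it below -/
import Mathlib

section
/- Let M ≥ 1 and let T be an M×M complex Hermitian positive semidefinite Toeplitz matrix with r = rank(T). Then there exist pairwise distinct θ_1, …, θ_r ∈ [0,1) and positive reals p_1, …, p_r such that T = Σ_{k=1}^r p_k · a(θ_k) a(θ_k)^H, where a(θ_k)^H denotes the conjugate transpose of the steering vector a(θ_k). -/
open Matrix
open scoped ComplexOrder

/-- The steering vector of an `M`-element ULA: `a(θ)_m = exp(2πi m θ)` for `m = 0, …, M-1`. -/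
noncomputable def steering (M : ℕ) (θ : ℝ) : Fin M → ℂ :=
  fun m => Complex.exp (2 * (Real.pi : ℂ) * Complex.I * ((m : ℕ) : ℂ) * (θ : ℂ))

open Module in
/-- The rank of a Gram matrix is the dimension of the span of the vectors. -/
theorem Matrix.rank_gram {ι E : Type*} [Fintype ι] [NormedAddCommGroup E]
    [InnerProductSpace ℂ E] [FiniteDimensional ℂ E] (v : ι → E) :
    (gram ℂ v).rank = finrank ℂ (Submodule.span ℂ (Set.range v)) := by
  let b := stdOrthonormalBasis ℂ E
  let e : E ≃ₗ[ℂ] (Fin (finrank ℂ E) → ℂ) := b.repr.toLinearEquiv.trans (WithLp.linearEquiv 2 ℂ _)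
  rw [gram_eq_conjTranspose_mul b, rank_conjTranspose_mul_self, rank_eq_finrank_span_cols,
    ← LinearEquiv.finrank_map_eq e, Submodule.map_span, ← Set.range_comp]
  rfl

open scoped MatrixOrder in
/-- A positive semidefinite matrix is the Gram matrix of vectors in a space whose dimension is
its rank. -/
theorem Matrix.PosSemidef.exists_gram_eq {ι : Type*} [Fintype ι] {T : Matrix ι ι ℂ}
    (hT : T.PosSemidef) :
    ∃ (S : Submodule ℂ (EuclideanSpace ℂ ι)) (v : ι → S),
      Module.finrank ℂ S = T.rank ∧ gram ℂ v = T := by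
  classical
  obtain ⟨B, rfl⟩ : ∃ B : Matrix ι ι ℂ, T = Bᴴ * B :=
    CStarAlgebra.nonneg_iff_eq_star_mul_self.mp hT.nonneg
  let v : ι → EuclideanSpace ℂ ι := fun i => WithLp.toLp 2 (B.col i)
  have hv : gram ℂ v = Bᴴ * B := by
    rw [gram_eq_conjTranspose_mul (EuclideanSpace.basisFun ι ℂ)]
    rfl
  refine ⟨Submodule.span ℂ (Set.range v),
    fun i => ⟨v i, Submodule.subset_span (Set.mem_range_self i)⟩, ?_, ?_⟩
  · rw [← hv, rank_gram]
  · rw [← hv]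
    rfl

/-- Two families with the same Gram matrix are related by a linear isometry of the space. -/
theorem exists_linearIsometry_of_gram_eq {ι E : Type*} [Fintype ι] [NormedAddCommGroup E]
    [InnerProductSpace ℂ E] [FiniteDimensional ℂ E] {v w : ι → E}
    (h : gram ℂ v = gram ℂ w) : ∃ U : E →ₗᵢ[ℂ] E, ∀ i, U (v i) = w i := by
  classical
  let f := Fintype.linearCombination ℂ v
  let g := Fintype.linearCombination ℂ w
  have hnorm : ∀ x, ‖g x‖ = ‖f x‖ := by
    intro x
    have : inner ℂ (g x) (g x) = inner ℂ (f x) (f x) := by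
      simp only [f, g, Fintype.linearCombination_apply]
      rw [← star_dotProduct_gram_mulVec, ← star_dotProduct_gram_mulVec, h]
    rw [inner_self_eq_norm_sq_to_K, inner_self_eq_norm_sq_to_K] at this
    exact (sq_eq_sq₀ (norm_nonneg _) (norm_nonneg _)).mp (by exact_mod_cast this)
  have hker : f.ker ≤ g.ker := fun x hx => by
    rw [LinearMap.mem_ker] at hx ⊢
    rw [← norm_eq_zero, hnorm, hx, norm_zero]
  let L₀ : f.range →ₗ[ℂ] E := f.ker.liftQ g hker ∘ₗ f.quotKerEquivRange.symm.toLinearMap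
  have hL₀ : ∀ x, L₀ ⟨f x, LinearMap.mem_range_self f x⟩ = g x := by
    intro x
    have : f.quotKerEquivRange.symm ⟨f x, LinearMap.mem_range_self f x⟩ = f.ker.mkQ x :=
      f.quotKerEquivRange_symm_apply_image x _
    simp [L₀, this]
  let L : f.range →ₗᵢ[ℂ] E := ⟨L₀, by
    rintro ⟨_, x, rfl⟩
    rw [hL₀, hnorm]
    rfl⟩
  refine ⟨L.extend, fun i => ?_⟩
  have hf : f (Pi.single i 1) = v i := by simp [f]
  have hg : g (Pi.single i 1) = w i := by simp [g]
  rw [← hf, ← hg, ← hL₀]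
  exact L.extend_apply ⟨f (Pi.single i 1), LinearMap.mem_range_self f _⟩

/-- A linear isometry of a finite-dimensional space is semisimple. -/
theorem LinearIsometry.isSemisimple {E : Type*} [NormedAddCommGroup E]
    [InnerProductSpace ℂ E] [FiniteDimensional ℂ E] (U : E →ₗᵢ[ℂ] E) :
    Module.End.IsSemisimple U.toLinearMap := by
  rw [Module.End.isSemisimple_iff]
  intro p hp
  refine ⟨pᗮ, fun x hx y hy => ?_, p.isCompl_orthogonal⟩
  have hinj : Function.Injective (U.toLinearMap.restrict hp) := fun a b hab =>
    Subtype.ext (U.injective (congrArg Subtype.val hab))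
  obtain ⟨z, hz⟩ := LinearMap.surjective_of_injective hinj ⟨y, hy⟩
  have hzy : U z = y := congrArg Subtype.val hz
  rw [← hzy]
  exact (U.inner_map_map z x).trans (hx z z.2)

/-- The correlation sequence of the orbit of a vector under a linear isometry is a positive
combination of characters, with at most as many terms as the dimension. -/
theorem LinearIsometry.exists_inner_pow_eq_sum {E : Type*} [NormedAddCommGroup E]
    [InnerProductSpace ℂ E] [FiniteDimensional ℂ E] (U : E →ₗᵢ[ℂ] E) (x : E) :
    ∃ (s : Finset ℂ) (p : ℂ → ℝ), s.card ≤ Module.finrank ℂ E ∧ (∀ μ ∈ s, ‖μ‖ = 1 ∧ 0 < p μ) ∧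
      ∀ i j : ℕ, inner ℂ ((U.toLinearMap ^ i) x) ((U.toLinearMap ^ j) x) =
        ∑ μ ∈ s, (p μ : ℂ) * (star μ ^ i * μ ^ j) := by
  obtain ⟨w, hw, hx⟩ := (Submodule.mem_iSup_iff_exists_finsupp _ x).mp
    (U.isSemisimple.iSup_eigenspace_eq_top ▸ Submodule.mem_top : x ∈ _)
  have hvec : ∀ μ ∈ w.support, Module.End.HasEigenvector U.toLinearMap μ (w μ) := fun μ hμ =>
    ⟨hw μ, Finsupp.mem_support_iff.mp hμ⟩
  have hnorm : ∀ μ ∈ w.support, ‖μ‖ = 1 := fun μ hμ => by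
    have h := U.norm_map (w μ)
    have h' : U (w μ) = μ • w μ := (hvec μ hμ).apply_eq_smul
    rw [h', norm_smul] at h
    exact mul_eq_right₀ (norm_ne_zero_iff.mpr (hvec μ hμ).2) |>.mp h
  have hpow : ∀ i : ℕ, (U.toLinearMap ^ i) x = ∑ μ ∈ w.support, μ ^ i • w μ := fun i => by
    rw [← hx, Finsupp.sum, map_sum]
    exact Finset.sum_congr rfl fun μ hμ => (hvec μ hμ).pow_apply i
  have horth : ∀ μ ∈ w.support, ∀ ν ∈ w.support, ν ≠ μ → inner ℂ (w μ) (w ν) = 0 := by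
    intro μ hμ ν hν hne
    have h := U.inner_map_map (w μ) (w ν)
    have h₁ : U (w μ) = μ • w μ := (hvec μ hμ).apply_eq_smul
    have h₂ : U (w ν) = ν • w ν := (hvec ν hν).apply_eq_smul
    rw [h₁, h₂, inner_smul_left, inner_smul_right, ← mul_assoc] at h
    by_contra h0
    have h1 := (mul_eq_right₀ h0).mp h
    apply hne
    have h2 : μ * (starRingEnd ℂ) μ = 1 := by
      rw [Complex.mul_conj']
      simp [hnorm μ hμ]
    calc ν = μ * (starRingEnd ℂ) μ * ν := by rw [h2, one_mul]
      _ = μ := by rw [mul_assoc, h1, mul_one]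
  refine ⟨w.support, fun μ => ‖w μ‖ ^ 2, ?_, fun μ hμ => ⟨hnorm μ hμ, ?_⟩, fun i j => ?_⟩
  · have hli := Module.End.eigenvectors_linearIndependent' U.toLinearMap
      (fun μ : w.support => (μ : ℂ)) Subtype.coe_injective (fun μ => w μ) (fun μ => hvec μ μ.2)
    simpa using hli.fintype_card_le_finrank
  · have := norm_pos_iff.mpr (hvec μ hμ).2
    positivity
  · rw [hpow, hpow, sum_inner]
    refine Finset.sum_congr rfl fun μ hμ => ?_
    rw [inner_sum, Finset.sum_eq_single_of_mem μ hμ]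
    · rw [inner_smul_left, inner_smul_right, inner_self_eq_norm_sq_to_K]
      simp
      ring
    · intro ν hν hne
      rw [inner_smul_left, inner_smul_right, horth μ hμ ν hν hne, mul_zero, mul_zero]

/-- Every complex number of modulus one is `exp (2πiθ)` for some `θ ∈ [0, 1)`. -/
theorem Complex.exists_mem_Ico_exp_eq {z : ℂ} (hz : ‖z‖ = 1) :
    ∃ θ ∈ Set.Ico (0 : ℝ) 1, Complex.exp (2 * (Real.pi : ℂ) * Complex.I * (θ : ℂ)) = z := by
  refine ⟨Int.fract (z.arg / (2 * Real.pi)), ⟨Int.fract_nonneg _, Int.fract_lt_one _⟩, ?_⟩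
  have hpi : (Real.pi : ℂ) ≠ 0 := by exact_mod_cast Real.pi_ne_zero
  have harg : 2 * (Real.pi : ℂ) * Complex.I * (Int.fract (z.arg / (2 * Real.pi)) : ℝ) =
      z.arg * Complex.I - (⌊z.arg / (2 * Real.pi)⌋ : ℤ) * (2 * Real.pi * Complex.I) := by
    rw [Int.fract]
    push_cast
    field_simp
  rw [harg, Complex.exp_periodic.sub_int_mul_eq]
  simpa [hz] using Complex.norm_mul_exp_arg_mul_I z

/-- The entries of a positive semidefinite Toeplitz matrix are a positive combination of
characters, with at most as many terms as the rank. -/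
theorem Matrix.PosSemidef.exists_toeplitz_eq_sum {n : ℕ}
    {T : Matrix (Fin (n + 1)) (Fin (n + 1)) ℂ} (hT : T.PosSemidef)
    (hToep : ∀ i j : Fin n, T i.castSucc j.castSucc = T i.succ j.succ) :
    ∃ (s : Finset ℂ) (p : ℂ → ℝ), s.card ≤ T.rank ∧ (∀ μ ∈ s, ‖μ‖ = 1 ∧ 0 < p μ) ∧
      ∀ i j, T i j = ∑ μ ∈ s, (p μ : ℂ) * (star μ ^ (i : ℕ) * μ ^ (j : ℕ)) := by
  obtain ⟨S, v, hS, rfl⟩ := hT.exists_gram_eq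
  obtain ⟨U, hU⟩ := exists_linearIsometry_of_gram_eq
    (v := fun i : Fin n => v i.castSucc) (w := fun i => v i.succ) (Matrix.ext hToep)
  have hv : ∀ i, v i = (U.toLinearMap ^ (i : ℕ)) (v 0) := by
    intro i
    induction i using Fin.induction with
    | zero => simp
    | succ i ih =>
      rw [← hU, ih, Fin.val_succ, pow_succ']
      rfl
  obtain ⟨s, p, hcard, hp, hsum⟩ := U.exists_inner_pow_eq_sum (v 0)
  refine ⟨s, p, hS ▸ hcard, hp, fun i j => ?_⟩
  rw [gram_apply, hv i, hv j, hsum]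

/-- A weighted sum of `k` rank-one matrices has rank at most `k`. -/
theorem Matrix.rank_sum_smul_vecMulVec_le {m κ : Type*} [Fintype m] [Fintype κ]
    (c : κ → ℂ) (a b : κ → m → ℂ) :
    (∑ k, c k • vecMulVec (a k) (b k)).rank ≤ Fintype.card κ := by
  have h : ∑ k, c k • vecMulVec (a k) (b k) =
      (of fun i k => c k * a k i) * (of fun k j => b k j) := by
    ext i j
    simp [Matrix.sum_apply, mul_apply, vecMulVec_apply, mul_assoc]
  rw [h]
  exact (rank_mul_le_left _ _).trans (rank_le_card_width _)

/-- Vandermonde decomposition (existence): any `M × M` Hermitian positive semidefinite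
Toeplitz matrix `T` of rank `r` can be written as `∑ k, p k • a(θ k) a(θ k)ᴴ` with
pairwise distinct `θ k ∈ [0,1)` and positive `p k`. -/
theorem vandermonde_decomposition_exists (M : ℕ) (hM : 1 ≤ M)
    (T : Matrix (Fin M) (Fin M) ℂ) (hT : T.PosSemidef)
    (hToep : ∀ j l j' l' : Fin M, (j : ℤ) - (l : ℤ) = (j' : ℤ) - (l' : ℤ) → T j l = T j' l') :
    ∃ (θ : Fin T.rank → ℝ) (p : Fin T.rank → ℝ),
      Function.Injective θ ∧ (∀ k, θ k ∈ Set.Ico (0 : ℝ) 1) ∧ (∀ k, 0 < p k) ∧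
      T = ∑ k, (p k : ℂ) • Matrix.vecMulVec (steering M (θ k)) (star (steering M (θ k))) := by
  obtain ⟨n, rfl⟩ : ∃ n, M = n + 1 := ⟨M - 1, by omega⟩
  obtain ⟨s, p, hcard, hp, hsum⟩ := hT.exists_toeplitz_eq_sum
    (fun i j => hToep _ _ _ _ (by simp))
  choose! t ht hexp using fun (z : ℂ) (hz : ‖z‖ = 1) => Complex.exists_mem_Ico_exp_eq hz
  have hexp' : ∀ μ ∈ s, Complex.exp (2 * (Real.pi : ℂ) * Complex.I * (t (star μ) : ℂ)) = star μ :=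
    fun μ hμ => hexp _ (by rw [norm_star]; exact (hp μ hμ).1)
  have hsteer : ∀ μ ∈ s, ∀ i : Fin (n + 1),
      steering (n + 1) (t (star μ)) i = star μ ^ (i : ℕ) := by
    intro μ hμ i
    rw [← hexp' μ hμ, ← Complex.exp_nat_mul, steering]
    congr 1
    rw [hexp' μ hμ]
    ring
  have hT_eq : T = ∑ μ : s, (p μ : ℂ) • Matrix.vecMulVec (steering (n + 1) (t (star (μ : ℂ))))
      (star (steering (n + 1) (t (star (μ : ℂ))))) := by
    ext i j
    rw [hsum, Matrix.sum_apply, ← Finset.sum_coe_sort s]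
    refine Finset.sum_congr rfl fun μ _ => ?_
    rw [Matrix.smul_apply, Matrix.vecMulVec_apply, Pi.star_apply, hsteer μ μ.2, hsteer μ μ.2,
      star_pow, star_star, smul_eq_mul]
  have hrank : s.card = T.rank := by
    refine hcard.antisymm ?_
    conv_lhs => rw [hT_eq]
    simpa using Matrix.rank_sum_smul_vecMulVec_le (fun μ : s => (p μ : ℂ)) _ _
  let e : Fin T.rank ≃ s := (s.equivFinOfCardEq hrank).symm
  refine ⟨fun k => t (star (e k : ℂ)), fun k => p (e k), fun k l hkl => ?_, fun k => ?_,
    fun k => (hp _ (e k).2).2, ?_⟩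
  · apply e.injective
    apply Subtype.ext
    apply star_injective
    rw [← hexp' _ (e k).2, ← hexp' _ (e l).2]
    simp only at hkl
    rw [hkl]
  · exact ht _ (by rw [norm_star]; exact (hp _ (e k).2).1)
  · conv_lhs => rw [hT_eq]
    exact (e.sum_comp fun μ : s => (p μ : ℂ) • Matrix.vecMulVec
      (steering (n + 1) (t (star (μ : ℂ)))) (star (steering (n + 1) (t (star (μ : ℂ)))))).symm
end

section
/- Let M ≥ 1, let r, s be integers with r ≤ M−1 and s ≤ M−1, let θ_1, …, θ_r ∈ [0,1) be pairwise distinct, let φ_1, …, φ_s ∈ [0,1) be pairwise distinct, and let p_1, …, p_r and q_1, …, q_s be positive reals. If Σ_{k=1}^r p_k · a(θ_k) a(θ_k)^H = Σ_{j=1}^s q_j · a(φ_j) a(φ_j)^H as M×M complex matrices, then r = s and there exists a permutation π of {1,…,r} such that φ_{π(k)} = θ_k and q_{π(k)} = p_k for all k. -/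
open Matrix

open Polynomial in
theorem dotProduct_steering (M : ℕ) (θ : ℝ) (f : ℂ[X]) (hf : f.natDegree < M) :
    (fun m : Fin M => f.coeff m) ⬝ᵥ steering M θ =
      f.eval (Complex.exp (2 * (Real.pi : ℂ) * Complex.I * (θ : ℂ))) := by
  rw [eval_eq_sum_range' hf, Finset.sum_range, dotProduct]
  refine Finset.sum_congr rfl fun m _ => ?_
  rw [← Complex.exp_nat_mul, steering]
  congr 2
  ring

theorem quadraticForm_steering (M : ℕ) (θ : ℝ) (f : Polynomial ℂ) (hf : f.natDegree < M) :
    ((fun m : Fin M => f.coeff m) ᵥ* Matrix.vecMulVec (steering M θ) (star (steering M θ))) ⬝ᵥ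
      star (fun m : Fin M => f.coeff m) =
      ((Complex.normSq (f.eval
        (Complex.exp (2 * (Real.pi : ℂ) * Complex.I * (θ : ℂ)))) : ℝ) : ℂ) := by
  rw [Matrix.vecMul_vecMulVec, smul_dotProduct, Matrix.star_dotProduct_star,
    dotProduct_steering M θ f hf, smul_eq_mul, ← Complex.mul_conj, Complex.star_def]

theorem sum_normSq_eval_eq {M r s : ℕ} {θ : Fin r → ℝ} {φ : Fin s → ℝ} {p : Fin r → ℝ}
    {q : Fin s → ℝ}
    (heq : ∑ k, (p k : ℂ) • Matrix.vecMulVec (steering M (θ k)) (star (steering M (θ k)))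
         = ∑ j, (q j : ℂ) • Matrix.vecMulVec (steering M (φ j)) (star (steering M (φ j))))
    (f : Polynomial ℂ) (hf : f.natDegree < M) :
    ∑ k, p k * Complex.normSq
        (f.eval (Complex.exp (2 * (Real.pi : ℂ) * Complex.I * (θ k : ℂ)))) =
      ∑ j, q j * Complex.normSq
        (f.eval (Complex.exp (2 * (Real.pi : ℂ) * Complex.I * (φ j : ℂ)))) := by
  have h := congrArg (fun A => ((fun m : Fin M => f.coeff m) ᵥ* A) ⬝ᵥ
    star (fun m : Fin M => f.coeff m)) heq
  simp only [Matrix.vecMul_sum, sum_dotProduct, Matrix.vecMul_smul, smul_dotProduct,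
    quadraticForm_steering _ _ f hf, smul_eq_mul] at h
  exact_mod_cast h

theorem exp_two_pi_I_mul_injOn :
    Set.InjOn (fun θ : ℝ => Complex.exp (2 * (Real.pi : ℂ) * Complex.I * (θ : ℂ)))
      (Set.Ico (0 : ℝ) 1) := by
  intro x hx y hy h
  obtain ⟨n, hn⟩ := Complex.exp_eq_exp_iff_exists_int.1 h
  have h1 : (x : ℂ) = y + n := by
    apply mul_left_cancel₀ Complex.two_pi_I_ne_zero
    rw [hn]
    ring
  have h2 : x = y + n := by exact_mod_cast h1
  have h3 : n = 0 := by
    have h4 : n < 1 := by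
      have : (n : ℝ) < 1 := by linarith [hx.2, hy.1]
      exact_mod_cast this
    have h5 : -1 < n := by
      have : (-1 : ℝ) < n := by linarith [hx.1, hy.2]
      exact_mod_cast this
    lia
  simpa [h3] using h2

theorem exists_frequency_eq {M r s : ℕ} (hM : 1 ≤ M) (hr : r ≤ M - 1)
    {θ : Fin r → ℝ} {φ : Fin s → ℝ} {p : Fin r → ℝ} {q : Fin s → ℝ}
    (hθmem : ∀ k, θ k ∈ Set.Ico (0 : ℝ) 1) (hφmem : ∀ j, φ j ∈ Set.Ico (0 : ℝ) 1)
    (hq : ∀ j, 0 < q j)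
    (heq : ∑ k, (p k : ℂ) • Matrix.vecMulVec (steering M (θ k)) (star (steering M (θ k)))
         = ∑ j, (q j : ℂ) • Matrix.vecMulVec (steering M (φ j)) (star (steering M (φ j))))
    (j : Fin s) : ∃ k, θ k = φ j := by
  have h := sum_normSq_eval_eq heq
    (∏ k, (Polynomial.X -
      Polynomial.C (Complex.exp (2 * (Real.pi : ℂ) * Complex.I * (θ k : ℂ)))))
    (by rw [Polynomial.natDegree_finsetProd_X_sub_C_eq_card, Finset.card_univ,
          Fintype.card_fin]; lia)
  simp only [Polynomial.eval_prod, Polynomial.eval_sub, Polynomial.eval_X,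
    Polynomial.eval_C] at h
  rw [Finset.sum_eq_zero, eq_comm, Finset.sum_eq_zero_iff_of_nonneg] at h
  · have hj := h j (Finset.mem_univ j)
    rw [mul_eq_zero, or_iff_right (hq j).ne', Complex.normSq_eq_zero,
      Finset.prod_eq_zero_iff] at hj
    obtain ⟨k, -, hk⟩ := hj
    exact ⟨k, (exp_two_pi_I_mul_injOn (hφmem j) (hθmem k) (sub_eq_zero.1 hk)).symm⟩
  · exact fun i _ => mul_nonneg (hq i).le (Complex.normSq_nonneg _)
  · intro k _
    rw [Finset.prod_eq_zero (Finset.mem_univ k) (sub_self _), map_zero, mul_zero]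

/-- Vandermonde decomposition (uniqueness): if two sums of at most `M - 1` rank-one steering
outer products with pairwise distinct frequencies in `[0,1)` and positive powers agree,
then they have the same number of terms and agree up to a permutation. -/
theorem vandermonde_decomposition_unique (M r s : ℕ) (hM : 1 ≤ M)
    (hr : r ≤ M - 1) (hs : s ≤ M - 1)
    (θ : Fin r → ℝ) (φ : Fin s → ℝ) (p : Fin r → ℝ) (q : Fin s → ℝ)
    (hθ : Function.Injective θ) (hφ : Function.Injective φ)
    (hθmem : ∀ k, θ k ∈ Set.Ico (0 : ℝ) 1) (hφmem : ∀ j, φ j ∈ Set.Ico (0 : ℝ) 1)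
    (hp : ∀ k, 0 < p k) (hq : ∀ j, 0 < q j)
    (heq : ∑ k, (p k : ℂ) • Matrix.vecMulVec (steering M (θ k)) (star (steering M (θ k)))
         = ∑ j, (q j : ℂ) • Matrix.vecMulVec (steering M (φ j)) (star (steering M (φ j)))) :
    r = s ∧ ∃ e : Fin r ≃ Fin s, ∀ k, φ (e k) = θ k ∧ q (e k) = p k := by
  choose g hg using exists_frequency_eq hM hs hφmem hθmem hp heq.symm
  have hginj : Function.Injective g := fun a b hab => hθ (by rw [← hg a, ← hg b, hab])
  have hgsurj : Function.Surjective g := by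
    intro j
    obtain ⟨k, hk⟩ := exists_frequency_eq hM hr hθmem hφmem hq heq j
    exact ⟨k, hφ ((hg k).trans hk)⟩
  let e : Fin r ≃ Fin s := Equiv.ofBijective g ⟨hginj, hgsurj⟩
  have he : ∀ k, φ (e k) = θ k := hg
  refine ⟨Fin.equiv_iff_eq.1 ⟨e⟩, e, fun k => ⟨he k, ?_⟩⟩
  have h := sum_normSq_eval_eq heq
    (∏ l ∈ Finset.univ.erase k, (Polynomial.X -
      Polynomial.C (Complex.exp (2 * (Real.pi : ℂ) * Complex.I * (θ l : ℂ)))))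
    (by
      rw [Polynomial.natDegree_finsetProd_X_sub_C_eq_card]
      have := Finset.card_erase_le (s := Finset.univ) (a := k)
      rw [Finset.card_univ, Fintype.card_fin] at this
      lia)
  rw [← Equiv.sum_comp e] at h
  simp only [he, Polynomial.eval_prod, Polynomial.eval_sub, Polynomial.eval_X,
    Polynomial.eval_C] at h
  have hvanish : ∀ i, i ≠ k → ∏ l ∈ Finset.univ.erase k,
      (Complex.exp (2 * (Real.pi : ℂ) * Complex.I * (θ i : ℂ)) -
        Complex.exp (2 * (Real.pi : ℂ) * Complex.I * (θ l : ℂ))) = 0 := fun i hi =>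
    Finset.prod_eq_zero (Finset.mem_erase.2 ⟨hi, Finset.mem_univ i⟩) (sub_self _)
  rw [Fintype.sum_eq_single k fun i hi => by rw [hvanish i hi, map_zero, mul_zero],
    Fintype.sum_eq_single k fun i hi => by rw [hvanish i hi, map_zero, mul_zero]] at h
  refine (mul_right_cancel₀ ?_ h).symm
  rw [Ne, Complex.normSq_eq_zero, Finset.prod_eq_zero_iff]
  rintro ⟨l, hl, hkl⟩
  exact Finset.ne_of_mem_erase hl
    (hθ (exp_two_pi_I_mul_injOn (hθmem k) (hθmem l) (sub_eq_zero.1 hkl))).symm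
end

section
/- Let M ≥ 1 and let A and B be M×M complex Hermitian positive definite matrices. Then tr(A^{-1} B) + tr(B^{-1} A) is a real number, tr(A^{-1} B) + tr(B^{-1} A) ≥ 2M, and equality holds if and only if A = B. -/
open Matrix
open scoped ComplexOrder

open scoped MatrixOrder in
theorem Matrix.PosSemidef.exists_eq_conjTranspose_mul_self {n : Type*} [Fintype n]
    [DecidableEq n] {A : Matrix n n ℂ} (hA : A.PosSemidef) :
    ∃ P : Matrix n n ℂ, A = Pᴴ * P :=
  CStarAlgebra.nonneg_iff_eq_star_mul_self.mp hA.nonneg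

/-- The excess of `tr(A⁻¹ B) + tr(B⁻¹ A)` over its minimum is the squared Frobenius norm of
`Q (A - B) Pᴴ`, where `A⁻¹ = Pᴴ P` and `B⁻¹ = Qᴴ Q`. -/
theorem trace_inv_mul_add_trace_inv_mul_eq {n : Type*} [Fintype n] [DecidableEq n]
    {A B P Q : Matrix n n ℂ} (hA : A.IsHermitian) (hB : B.IsHermitian)
    (hAu : IsUnit A.det) (hBu : IsUnit B.det) (hP : A⁻¹ = Pᴴ * P) (hQ : B⁻¹ = Qᴴ * Q) :
    (A⁻¹ * B).trace + (B⁻¹ * A).trace =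
      ((Q * (A - B) * Pᴴ)ᴴ * (Q * (A - B) * Pᴴ)).trace + 2 * Fintype.card n := by
  have hX : ((Q * (A - B) * Pᴴ)ᴴ * (Q * (A - B) * Pᴴ)).trace =
      (A⁻¹ * (A - B) * (B⁻¹ * (A - B))).trace := by
    rw [← Matrix.mul_assoc, trace_mul_comm, hP, hQ]
    simp only [conjTranspose_mul, conjTranspose_conjTranspose, (hA.sub hB).eq, Matrix.mul_assoc]
  rw [hX, Matrix.mul_sub, Matrix.mul_sub, nonsing_inv_mul A hAu, nonsing_inv_mul B hBu,
    Matrix.mul_sub, Matrix.sub_mul, Matrix.one_mul, Matrix.mul_assoc,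
    mul_nonsing_inv_cancel_left B A hBu,
    nonsing_inv_mul A hAu, Matrix.mul_one]
  simp only [trace_sub, trace_one]
  ring

/-- For Hermitian positive definite `A`, `B`, the quantity `tr(A⁻¹ B) + tr(B⁻¹ A)` is a
real number, is at least `2M`, and equals `2M` if and only if `A = B`. -/
theorem trace_inv_mul_add_trace_inv_mul_ge (M : ℕ) (hM : 1 ≤ M)
    (A B : Matrix (Fin M) (Fin M) ℂ) (hA : A.PosDef) (hB : B.PosDef) :
    ∃ t : ℝ, (A⁻¹ * B).trace + (B⁻¹ * A).trace = (t : ℂ) ∧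
      (2 * M : ℝ) ≤ t ∧ (t = 2 * M ↔ A = B) := by
  have hAu : IsUnit A.det := A.isUnit_iff_isUnit_det.mp hA.isUnit
  have hBu : IsUnit B.det := B.isUnit_iff_isUnit_det.mp hB.isUnit
  obtain ⟨P, hP⟩ := hA.inv.posSemidef.exists_eq_conjTranspose_mul_self
  obtain ⟨Q, hQ⟩ := hB.inv.posSemidef.exists_eq_conjTranspose_mul_self
  have key := trace_inv_mul_add_trace_inv_mul_eq hA.isHermitian hB.isHermitian hAu hBu hP hQ
  have hnonneg := (posSemidef_conjTranspose_mul_self (Q * (A - B) * Pᴴ)).trace_nonneg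
  have hzero : ((Q * (A - B) * Pᴴ)ᴴ * (Q * (A - B) * Pᴴ)).trace = 0 ↔ A = B := by
    rw [trace_conjTranspose_mul_self_eq_zero_iff]
    refine ⟨fun h => ?_, fun h => by simp [h]⟩
    have h' : B⁻¹ * (A - B) * A⁻¹ = 0 := by
      rw [hP, hQ]
      calc Qᴴ * Q * (A - B) * (Pᴴ * P) = Qᴴ * (Q * (A - B) * Pᴴ) * P := by
            simp only [Matrix.mul_assoc]
        _ = 0 := by rw [h, Matrix.mul_zero, Matrix.zero_mul]
    rw [← sub_eq_zero]
    calc A - B = B * (B⁻¹ * (A - B) * A⁻¹) * A := by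
          rw [← Matrix.mul_assoc, nonsing_inv_mul_cancel_right A _ hAu,
            mul_nonsing_inv_cancel_left B _ hBu]
      _ = 0 := by rw [h', Matrix.mul_zero, Matrix.zero_mul]
  obtain ⟨s, hs, hst : (s : ℂ) = _⟩ := RCLike.nonneg_iff_exists_ofReal.mp hnonneg
  rw [← hst] at key hzero
  refine ⟨s + 2 * M, ?_, by linarith, ?_⟩
  · rw [key, Fintype.card_fin]
    push_cast
    rfl
  · rw [← hzero, Complex.ofReal_eq_zero, add_eq_right]
end

section
/- Let M ≥ 1, let R be an M×M complex Hermitian positive definite matrix and let S be an M×M complex Hermitian matrix. Then tr(S R^{-1} S) + tr(R) − 2 tr(S) is a real number, tr(S R^{-1} S) + tr(R) − 2 tr(S) ≥ 0, and equality holds if and only if S = R. -/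
open Matrix
open scoped ComplexOrder

theorem Matrix.PosDef.conjTranspose_mul_mul_same_eq_zero_iff {m n : Type*} [Fintype m]
    [DecidableEq m] [Fintype n]
    {A : Matrix n n ℂ} (hA : A.PosDef) (B : Matrix n m ℂ) : Bᴴ * A * B = 0 ↔ B = 0 := by
  refine ⟨fun h => ?_, fun h => by simp [h]⟩
  refine Matrix.ext_of_mulVec_single fun j => ?_
  rw [zero_mulVec]
  by_contra hx
  have hpos := hA.dotProduct_mulVec_pos hx
  rw [star_mulVec, ← dotProduct_mulVec, mulVec_mulVec, mulVec_mulVec, h,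
    zero_mulVec, dotProduct_zero] at hpos
  exact hpos.false

/-- For Hermitian positive definite `R` and Hermitian `S`, the quantity
`tr(S R⁻¹ S) + tr(R) - 2 tr(S)` is a real number, is nonnegative, and equals `0`
if and only if `S = R`. -/
theorem covariance_fitting_criterion_nonneg (M : ℕ) (hM : 1 ≤ M)
    (R S : Matrix (Fin M) (Fin M) ℂ) (hR : R.PosDef) (hS : S.IsHermitian) :
    ∃ t : ℝ, (S * R⁻¹ * S).trace + R.trace - 2 * S.trace = (t : ℂ) ∧
      0 ≤ t ∧ (t = 0 ↔ S = R) := by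
  have hdet : IsUnit R.det := (Matrix.isUnit_iff_isUnit_det R).mp hR.isUnit
  have hexpand : (S - R)ᴴ * R⁻¹ * (S - R) = S * R⁻¹ * S + R - (S + S) := by
    rw [(hS.sub hR.isHermitian).eq, sub_mul, mul_nonsing_inv _ hdet, sub_mul, mul_sub,
      nonsing_inv_mul_cancel_right _ _ hdet, one_mul]
    abel
  have htrace : (S * R⁻¹ * S).trace + R.trace - 2 * S.trace
      = ((S - R)ᴴ * R⁻¹ * (S - R)).trace := by
    rw [hexpand, trace_sub, trace_add, trace_add, two_mul]
  have hpos : ((S - R)ᴴ * R⁻¹ * (S - R)).PosSemidef :=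
    hR.inv.posSemidef.conjTranspose_mul_mul_same _
  obtain ⟨t, ht, heq⟩ := RCLike.nonneg_iff_exists_ofReal.mp hpos.trace_nonneg
  refine ⟨t, htrace.trans heq.symm, ht, ?_⟩
  rw [← sub_eq_zero (a := S), ← hR.inv.conjTranspose_mul_mul_same_eq_zero_iff,
    ← hpos.trace_eq_zero_iff, ← heq]
  exact Complex.ofReal_eq_zero.symm
end
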